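/- Let (X_t)_{t=0,…,T} be an ℝ^d-valued Markov process, let μ_s denote the law of X_s, let f_t : ℝ^d → ℝ be bounded measurable payoff functions, and let the continuation values q_t be defined by the backward recursion q_T = 0 and, for t = T−1, …, 0, q_t is a bounded measurable function with q_t(X_t) = E[ max(f_{t+1}(X_{t+1}), q_{t+1}(X_{t+1})) | X_t ] almost surely. Fix t ∈ {0, …, T−1} and w ∈ {0, 1, …, T−t−1}, let h_{t+1}, …, h_{t+w+1} : ℝ^d → ℝ be bounded measurable functions, and let g be a bounded measurable function with g(X_t) = E[ ϑ_{t+1:w}(f, h_{t+1}, …, h_{t+w+1})(X_{t+1}, …, X_{t+w+1}) | X_t ] almost surely. Then ( ∫ |g(x) − q_t(x)|^2 μ_t(dx) )^{1/2} ≤ Σ_{s=t+1}^{t+w+1} ( ∫ |h_s(x) − q_s(x)|^2 μ_s(dx) )^{1/2}. -/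

import Mathlib

open MeasureTheory ProbabilityTheory Finset

/-- The look-ahead payoff `ϑ_{t:w}(f,h)(x_t, …, x_{t+w})` of Egloff–Kohler–Todorovic. -/
noncomputable def vartheta {E : Type*} (f h : ℕ → E → ℝ) (t w : ℕ) (x : ℕ → E) : ℝ :=
  (∑ s ∈ Finset.Icc t (t + w),
      f s (x s) * (if 0 ≤ f s (x s) - h s (x s) then (1 : ℝ) else 0) *
        ∏ r ∈ Finset.Ico t s, (if f r (x r) - h r (x r) < 0 then (1 : ℝ) else 0)) +
    h (t + w) (x (t + w)) *
      ∏ r ∈ Finset.Icc t (t + w), (if f r (x r) - h r (x r) < 0 then (1 : ℝ) else 0)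

/-- On `L²`, conditional expectation may be moved across the integral of a product. -/
theorem integral_condExp_mul_condExp {Ω : Type*} {m mΩ : MeasurableSpace Ω} {μ : Measure Ω}
    [IsFiniteMeasure μ] (hm : m ≤ mΩ) {u v : Ω → ℝ} (hu : MemLp u 2 μ) (hv : MemLp v 2 μ) :
    ∫ ω, (μ[u | m] * μ[v | m]) ω ∂μ = ∫ ω, (μ[u | m] * v) ω ∂μ := by
  have hint : Integrable (μ[u | m] * v) μ := (hu.condExp one_le_two).integrable_mul hv
  rw [← integral_condExp hm (f := μ[u | m] * v)]
  exact integral_congr_ae (condExp_mul_of_stronglyMeasurable_left stronglyMeasurable_condExp hint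
    (hv.integrable one_le_two)).symm

/-- If `m₁` and `m₂` are conditionally independent given `m' ≤ m₁`, then conditioning an
`m₂`-measurable function on `m₁` is the same as conditioning it on `m'`. -/
theorem condExp_eq_condExp_of_condIndep {Ω : Type*} {m' m₁ m₂ mΩ : MeasurableSpace Ω}
    [StandardBorelSpace Ω] {μ : Measure Ω} [IsFiniteMeasure μ] {hm' : m' ≤ mΩ} (hm₁ : m₁ ≤ mΩ)
    (hm₂ : m₂ ≤ mΩ) (hle : m' ≤ m₁) (hind : CondIndep m' m₁ m₂ hm' μ) {Y : Ω → ℝ}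
    (hY : StronglyMeasurable[m₂] Y) (hY2 : MemLp Y 2 μ) :
    μ[Y | m'] =ᵐ[μ] μ[Y | m₁] := by
  have hYint := hY2.integrable one_le_two
  refine ae_eq_condExp_of_forall_setIntegral_eq hm₁ hYint
    (fun _ _ _ => integrable_condExp.integrableOn) (fun A hA _ => ?_)
    (stronglyMeasurable_condExp.mono hle).aestronglyMeasurable
  have hind2 : ∀ {B : Set Ω}, MeasurableSet B → MemLp (B.indicator fun _ => (1 : ℝ)) 2 μ :=
    fun hB => memLp_indicator_const 2 hB 1 (Or.inr (measure_ne_top _ _))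
  have hset : ∀ {B : Set Ω} (u : Ω → ℝ), MeasurableSet B →
      ∫ ω in B, u ω ∂μ = ∫ ω, (u * B.indicator fun _ => (1 : ℝ)) ω ∂μ := by
    intro B u hB
    rw [← integral_indicator hB]
    refine integral_congr_ae (.of_forall fun ω => ?_)
    by_cases hω : ω ∈ B <;> simp [hω]
  set a : Ω → ℝ := A.indicator fun _ => (1 : ℝ)
  have ha2 : MemLp a 2 μ := hind2 (hm₁ _ hA)
  have hα2 : MemLp (μ[a | m']) 2 μ := ha2.condExp one_le_two
  have key : μ[μ[a | m'] | m₂] =ᵐ[μ] μ[a | m₂] := by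
    refine ae_eq_condExp_of_forall_setIntegral_eq hm₂ (ha2.integrable one_le_two)
      (fun _ _ _ => integrable_condExp.integrableOn) (fun B hB _ => ?_)
      stronglyMeasurable_condExp.aestronglyMeasurable
    have hAB := (condIndep_iff m' m₁ m₂ hm' hm₁ hm₂ μ).1 hind A B hA hB
    have hmul : a * (B.indicator fun _ => (1 : ℝ)) = (A ∩ B).indicator fun _ => (1 : ℝ) := by
      ext ω
      by_cases h₁ : ω ∈ A <;> by_cases h₂ : ω ∈ B <;> simp [a, h₁, h₂]
    rw [setIntegral_condExp hm₂ integrable_condExp hB, hset _ (hm₂ _ hB), hset _ (hm₂ _ hB),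
      ← integral_condExp_mul_condExp hm' ha2 (hind2 (hm₂ _ hB)), hmul,
      ← integral_condExp hm' (f := (A ∩ B).indicator fun _ => (1 : ℝ))]
    exact integral_congr_ae hAB.symm
  have hYm : μ[Y | m₂] = Y := condExp_of_stronglyMeasurable hm₂ hY hYint
  have h₁ := integral_condExp_mul_condExp hm₂ hY2 ha2
  have h₂ := integral_condExp_mul_condExp hm₂ hY2 hα2
  rw [hYm] at h₁ h₂
  calc ∫ ω in A, (μ[Y | m']) ω ∂μ
      = ∫ ω, (μ[a | m'] * Y) ω ∂μ := by
        rw [hset _ (hm₁ _ hA), ← integral_condExp_mul_condExp hm' hY2 ha2,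
          ← integral_condExp_mul_condExp hm' ha2 hY2, mul_comm]
    _ = ∫ ω, (Y * a) ω ∂μ := by
        rw [mul_comm, ← h₂, ← h₁]
        exact integral_congr_ae (key.mono fun ω hω => by simp [hω])
    _ = ∫ ω in A, Y ω ∂μ := (hset _ (hm₁ _ hA)).symm

/-- One step of the error propagation: `a`, `b`, `c` play the roles of the payoff, the surrogate
and the true continuation value at a time with information `m`, while `V` and `U` are the
look-ahead payoff and the optimal value one step later. -/
theorem abs_condExp_ite_sub_max_le {Ω : Type*} {m mΩ : MeasurableSpace Ω} {μ : Measure Ω}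
    [IsFiniteMeasure μ] (hm : m ≤ mΩ) {a b c V U : Ω → ℝ} (ha : Measurable[m] a)
    (hb : Measurable[m] b) (hc : Measurable[m] c) (hai : Integrable a μ) (hci : Integrable c μ)
    (hV : Integrable V μ) (hU : Integrable U μ) (hcU : c =ᵐ[μ] μ[U | m]) :
    ∀ᵐ ω ∂μ, ‖(μ[fun ω => (if b ω ≤ a ω then a ω else V ω) - max (a ω) (c ω) | m]) ω‖ ≤
      ‖(μ[fun ω => V ω - U ω | m]) ω‖ + ‖b ω - c ω‖ := by
  set S : Set Ω := {ω | b ω ≤ a ω}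
  have hS : MeasurableSet[m] S := measurableSet_le hb ha
  set r : Ω → ℝ := S.indicator (fun ω => a ω - max (a ω) (c ω)) +
    Sᶜ.indicator (fun ω => c ω - max (a ω) (c ω))
  have hrm : StronglyMeasurable[m] r :=
    (((ha.sub (ha.max hc)).indicator hS).add
      ((hc.sub (ha.max hc)).indicator hS.compl)).stronglyMeasurable
  have hri : Integrable r μ := ((hai.sub (hai.sup hci)).indicator (hm _ hS)).add
    ((hci.sub (hai.sup hci)).indicator (hm _ hS.compl))
  have hdec : (fun ω => (if b ω ≤ a ω then a ω else V ω) - max (a ω) (c ω)) =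
      Sᶜ.indicator (V - c) + r := by
    ext ω
    by_cases hω : b ω ≤ a ω <;> simp [r, S, hω]
  have hVc : Integrable (V - c) μ := hV.sub hci
  rw [hdec]
  filter_upwards [condExp_add (hVc.indicator (hm _ hS.compl)) hri m,
    condExp_indicator hVc hS.compl, condExp_sub hV hci m, condExp_sub hV hU m, hcU] with
    ω h₁ h₂ h₃ h₄ h₅
  have h₄' : (μ[fun ω => V ω - U ω | m]) ω = (μ[V | m]) ω - (μ[U | m]) ω := h₄
  rw [h₁, Pi.add_apply, h₂, condExp_of_stronglyMeasurable hm hrm hri, h₄', ← h₅]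
  rw [condExp_of_stronglyMeasurable hm hc.stronglyMeasurable hci] at h₃
  by_cases hω : b ω ≤ a ω
  · simp only [r, S, hω, Set.mem_compl_iff, Set.mem_ofPred_eq, not_true_eq_false,
      not_false_eq_true, Set.indicator_of_notMem, Set.indicator_of_mem, Pi.add_apply,
      zero_add, add_zero, Real.norm_eq_abs]
    have : |a ω - max (a ω) (c ω)| ≤ |b ω - c ω| := by
      rcases max_cases (a ω) (c ω) with ⟨h, h'⟩ | ⟨h, h'⟩ <;> rw [h] <;>
        rw [abs_le] <;> constructor <;> cases abs_cases (b ω - c ω) <;> linarith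
    linarith [abs_nonneg ((μ[V | m]) ω - c ω)]
  · simp only [r, S, hω, Set.mem_compl_iff, Set.mem_ofPred_eq, not_false_eq_true,
      Set.indicator_of_notMem, Set.indicator_of_mem, Pi.add_apply, zero_add]
    rw [h₃, Pi.sub_apply]
    refine (norm_add_le _ _).trans (add_le_add_right ?_ _)
    simp only [Real.norm_eq_abs]
    rcases max_cases (a ω) (c ω) with ⟨h, h'⟩ | ⟨h, h'⟩ <;> rw [h] <;>
      rw [abs_le] <;> constructor <;> cases abs_cases (b ω - c ω) <;> linarith

theorem vartheta_zero {E : Type*} (f h : ℕ → E → ℝ) (t : ℕ) (x : ℕ → E) :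
    vartheta f h t 0 x = max (f t (x t)) (h t (x t)) := by
  by_cases hc : h t (x t) ≤ f t (x t)
  · simp [vartheta, hc]
  · simp [vartheta, hc, not_le.1 hc, (not_le.1 hc).le]

/-- Backward recursion of the look-ahead payoff in its horizon. -/
theorem vartheta_succ {E : Type*} (f h : ℕ → E → ℝ) (t w : ℕ) (x : ℕ → E) :
    vartheta f h t (w + 1) x =
      if h t (x t) ≤ f t (x t) then f t (x t) else vartheta f h (t + 1) w x := by
  have hIcc : Icc t (t + (w + 1)) = insert t (Icc (t + 1) (t + 1 + w)) := by
    ext; simp only [mem_Icc, mem_insert]; omega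
  have hnot : t ∉ Icc (t + 1) (t + 1 + w) := by simp
  have hIco : ∀ s ∈ Icc (t + 1) (t + 1 + w), Ico t s = insert t (Ico (t + 1) s) := by
    intro s hs
    ext; simp only [mem_Icc, mem_Ico, mem_insert] at *; omega
  have hnot' : ∀ s, t ∉ Ico (t + 1) s := by simp
  have hend : t + (w + 1) = t + 1 + w := by omega
  unfold vartheta
  rw [hIcc, sum_insert hnot, prod_insert hnot, hend]
  by_cases hc : h t (x t) ≤ f t (x t)
  · rw [if_pos hc, sum_eq_zero]
    · simp [hc]
    · intro s hs
      rw [hIco s hs, prod_insert (hnot' s)]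
      simp [hc]
  · rw [if_neg hc]
    have hlt : f t (x t) - h t (x t) < 0 := by linarith
    simp only [hlt, if_true, not_le.2 hlt, if_false, mul_zero, zero_mul, zero_add, one_mul]
    congr 1
    refine sum_congr rfl fun s hs => ?_
    rw [hIco s hs, prod_insert (hnot' s), if_pos hlt, one_mul]

theorem measurable_vartheta {Ω E : Type*} [MeasurableSpace Ω] [MeasurableSpace E]
    {X : ℕ → Ω → E} (hX : ∀ t, Measurable (X t)) {f h : ℕ → E → ℝ}
    (hf : ∀ s, Measurable (f s)) (hh : ∀ s, Measurable (h s)) (t w : ℕ) :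
    Measurable fun ω => vartheta f h t w fun s => X s ω := by
  induction w generalizing t with
  | zero =>
    simp only [vartheta_zero]
    exact ((hf t).comp (hX t)).max ((hh t).comp (hX t))
  | succ w ih =>
    simp only [vartheta_succ]
    exact Measurable.ite (measurableSet_le ((hh t).comp (hX t)) ((hf t).comp (hX t)))
      ((hf t).comp (hX t)) (ih (t + 1))

theorem exists_abs_vartheta_le {E : Type*} {f h : ℕ → E → ℝ} (hfb : ∀ s, ∃ C, ∀ y, |f s y| ≤ C)
    (hhb : ∀ s, ∃ C, ∀ y, |h s y| ≤ C) (t w : ℕ) :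
    ∃ C, ∀ x, |vartheta f h t w x| ≤ C := by
  obtain ⟨A, hA⟩ := hfb t
  induction w generalizing t A with
  | zero =>
    obtain ⟨B, hB⟩ := hhb t
    refine ⟨max A B, fun x => ?_⟩
    rw [vartheta_zero]
    exact abs_max_le_max_abs_abs.trans (max_le_max (hA _) (hB _))
  | succ w ih =>
    obtain ⟨A', hA'⟩ := hfb (t + 1)
    obtain ⟨B, hB⟩ := ih (t + 1) A' hA'
    refine ⟨max A B, fun x => ?_⟩
    rw [vartheta_succ]
    split_ifs
    · exact (hA _).trans (le_max_left _ _)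
    · exact (hB _).trans (le_max_right _ _)

theorem memLp_comp_of_abs_le {Ω E : Type*} [MeasurableSpace Ω] [MeasurableSpace E]
    {μ : Measure Ω} [IsFiniteMeasure μ] {X : Ω → E} (hX : Measurable X) {u : E → ℝ}
    (hu : Measurable u) (hub : ∃ C, ∀ y, |u y| ≤ C) (p : ENNReal) :
    MemLp (fun ω => u (X ω)) p μ := by
  obtain ⟨C, hC⟩ := hub
  exact .of_bound (hu.comp hX).aestronglyMeasurable C (.of_forall fun ω => hC (X ω))

theorem sqrt_integral_sq_map {Ω E : Type*} [MeasurableSpace Ω] [MeasurableSpace E]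
    {μ : Measure Ω} {X : Ω → E} (hX : Measurable X) {u : E → ℝ} (hu : Measurable u)
    (hL : MemLp (fun ω => u (X ω)) 2 μ) :
    √(∫ y, u y ^ 2 ∂(μ.map X)) = (eLpNorm (fun ω => u (X ω)) 2 μ).toReal := by
  rw [integral_map hX.aemeasurable (hu.pow_const 2).aestronglyMeasurable,
    hL.eLpNorm_eq_integral_rpow_norm (by simp) (by simp),
    ENNReal.toReal_ofReal (by positivity), Real.sqrt_eq_rpow]
  simp

/-- Error propagation along a filtration `F` with respect to which the process is adapted and the
continuation values satisfy the dynamic programming recursion. -/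
theorem eLpNorm_condExp_vartheta_sub_le {Ω E : Type*} [mΩ : MeasurableSpace Ω]
    [MeasurableSpace E] {μ : Measure Ω} [IsFiniteMeasure μ] {F : ℕ → MeasurableSpace Ω}
    (hF : ∀ t, F t ≤ mΩ) (hmono : Monotone F) {X : ℕ → Ω → E} (hX : ∀ t, Measurable[F t] (X t))
    {f q h : ℕ → E → ℝ}
    (hf : ∀ s, Measurable (f s)) (hfb : ∀ s, ∃ C, ∀ y, |f s y| ≤ C)
    (hq : ∀ s, Measurable (q s)) (hqb : ∀ s, ∃ C, ∀ y, |q s y| ≤ C)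
    (hh : ∀ s, Measurable (h s)) (hhb : ∀ s, ∃ C, ∀ y, |h s y| ≤ C) {T : ℕ}
    (hqrec : ∀ t, t < T → (fun ω => q t (X t ω)) =ᵐ[μ]
      μ[fun ω => max (f (t + 1) (X (t + 1) ω)) (q (t + 1) (X (t + 1) ω)) | F t])
    (t w : ℕ) (htw : t + w + 1 ≤ T) :
    eLpNorm (μ[fun ω => vartheta f h (t + 1) w (fun s => X s ω) -
        max (f (t + 1) (X (t + 1) ω)) (q (t + 1) (X (t + 1) ω)) | F t]) 2 μ ≤
      ∑ s ∈ Icc (t + 1) (t + w + 1),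
        eLpNorm (fun ω => h s (X s ω) - q s (X s ω)) 2 μ := by
  have hX' : ∀ t, Measurable (X t) := fun t => (hX t).mono (hF t) le_rfl
  induction w generalizing t with
  | zero =>
    simp only [add_zero, Icc_self, sum_singleton, vartheta_zero]
    refine (eLpNorm_condExp_le_eLpNorm _ one_le_two).trans (eLpNorm_mono fun ω => ?_)
    rw [Real.norm_eq_abs, Real.norm_eq_abs, max_comm, max_comm _ (q _ _)]
    exact abs_max_sub_max_le_abs _ _ _
  | succ w ih =>
    have hint : ∀ (s : ℕ) {u : E → ℝ}, Measurable u → (∃ C, ∀ y, |u y| ≤ C) →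
        Integrable (fun ω => u (X s ω)) μ := fun s _ hu hub =>
      (memLp_comp_of_abs_le (hX' s) hu hub 1).integrable le_rfl
    have hVint : Integrable (fun ω => vartheta f h (t + 1 + 1) w fun s => X s ω) μ := by
      obtain ⟨C, hC⟩ := exists_abs_vartheta_le hfb hhb (t + 1 + 1) w
      exact .of_bound (measurable_vartheta hX' hf hh _ _).aestronglyMeasurable C
        (.of_forall fun ω => hC _)
    have hstep := abs_condExp_ite_sub_max_le (hF (t + 1))
      ((hf (t + 1)).comp (hX (t + 1))) ((hh (t + 1)).comp (hX (t + 1)))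
      ((hq (t + 1)).comp (hX (t + 1))) (hint _ (hf _) (hfb _)) (hint _ (hq _) (hqb _)) hVint
      ((hint (t + 1 + 1) (hf _) (hfb _)).sup (hint (t + 1 + 1) (hq _) (hqb _)))
      (hqrec (t + 1) (by omega))
    have hIcc : Icc (t + 1) (t + (w + 1) + 1) =
        insert (t + 1) (Icc (t + 1 + 1) (t + 1 + w + 1)) := by
      ext; simp only [mem_Icc, mem_insert]; omega
    rw [hIcc, sum_insert (by simp), add_comm (eLpNorm _ 2 μ)]
    simp only [vartheta_succ]
    refine (eLpNorm_congr_ae (condExp_condExp_of_le (hmono (Nat.le_add_right t 1)) (hF (t + 1)))).symm.trans_le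
      ((eLpNorm_condExp_le_eLpNorm _ one_le_two).trans ?_)
    refine (eLpNorm_mono_ae_real hstep).trans ((eLpNorm_add_le ?_ ?_ one_le_two).trans ?_)
    · exact integrable_condExp.aestronglyMeasurable.norm
    · exact (((hh _).comp (hX' _)).sub ((hq _).comp (hX' _))).norm.aestronglyMeasurable
    · rw [eLpNorm_norm, eLpNorm_norm]
      exact add_le_add_left (ih (t + 1) (by omega)) _

/-- **Error propagation inequality** (Proposition 6.4 of Egloff (2005), inequality (3.7)).
If `g(X_t) = E[ϑ_{t+1:w}(f, h_{t+1},…,h_{t+w+1})(X_{t+1},…,X_{t+w+1}) | X_t]` a.s., where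
the `h_s` are bounded measurable surrogates for the continuation values `q_s`, then
`(∫ |g − q_t|² dμ_t)^{1/2} ≤ Σ_{s=t+1}^{t+w+1} (∫ |h_s − q_s|² dμ_s)^{1/2}`,
with `μ_s` the law of `X_s`. -/
theorem error_propagation
    {Ω : Type*} [MeasurableSpace Ω] [StandardBorelSpace Ω]
    (Pr : Measure Ω) [IsProbabilityMeasure Pr]
    (d T : ℕ) (X : ℕ → Ω → (Fin d → ℝ)) (hX : ∀ t, Measurable (X t))
    (hMarkov : ∀ t, CondIndep (MeasurableSpace.comap (X t) inferInstance)
        (⨆ s ∈ Set.Iic t, MeasurableSpace.comap (X s) inferInstance)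
        (⨆ s ∈ Set.Icc (t + 1) T, MeasurableSpace.comap (X s) inferInstance)
        ((hX t).comap_le) Pr)
    (f q : ℕ → (Fin d → ℝ) → ℝ)
    (hf : ∀ s, Measurable (f s)) (hfb : ∀ s, ∃ C, ∀ y, |f s y| ≤ C)
    (hq : ∀ s, Measurable (q s)) (hqb : ∀ s, ∃ C, ∀ y, |q s y| ≤ C)
    (hqT : q T = 0)
    (hqrec : ∀ t, t < T →
      (fun ω => q t (X t ω)) =ᵐ[Pr]
        Pr[fun ω => max (f (t + 1) (X (t + 1) ω)) (q (t + 1) (X (t + 1) ω)) |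
            MeasurableSpace.comap (X t) inferInstance])
    (t w : ℕ) (htw : t + w + 1 ≤ T)
    (h : ℕ → (Fin d → ℝ) → ℝ)
    (hh : ∀ s, Measurable (h s)) (hhb : ∀ s, ∃ C, ∀ y, |h s y| ≤ C)
    (g : (Fin d → ℝ) → ℝ) (hg : Measurable g) (hgb : ∃ C, ∀ y, |g y| ≤ C)
    (hgrep : (fun ω => g (X t ω)) =ᵐ[Pr]
        Pr[fun ω => vartheta f h (t + 1) w (fun s => X s ω) |
            MeasurableSpace.comap (X t) inferInstance]) :
    Real.sqrt (∫ y, (g y - q t y) ^ 2 ∂(Pr.map (X t)))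
      ≤ ∑ s ∈ Finset.Icc (t + 1) (t + w + 1),
          Real.sqrt (∫ y, (h s y - q s y) ^ 2 ∂(Pr.map (X s))) := by
  set F : ℕ → MeasurableSpace Ω := fun t =>
    ⨆ s ∈ Set.Iic t, MeasurableSpace.comap (X s) inferInstance
  have hF : ∀ t, F t ≤ ‹MeasurableSpace Ω› := fun t => iSup₂_le fun s _ => (hX s).comap_le
  have hmono : Monotone F := fun i j hij => biSup_mono fun s hs => le_trans hs hij
  have hle : ∀ t, MeasurableSpace.comap (X t) inferInstance ≤ F t := fun t =>
    le_iSup₂_of_le t (Set.mem_Iic.2 le_rfl) le_rfl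
  have hXF : ∀ t, Measurable[F t] (X t) := fun t => measurable_iff_comap_le.2 (hle t)
  have hL : ∀ (s : ℕ) {u : (Fin d → ℝ) → ℝ}, Measurable u → (∃ C, ∀ y, |u y| ≤ C) →
      MemLp (fun ω => u (X s ω)) 2 Pr := fun s _ hu hub => memLp_comp_of_abs_le (hX s) hu hub 2
  have hUL : ∀ s, MemLp (fun ω => max (f s (X s ω)) (q s (X s ω))) 2 Pr := fun s =>
    (hL s (hf s) (hfb s)).sup (hL s (hq s) (hqb s))
  have hrec : ∀ t, t < T → (fun ω => q t (X t ω)) =ᵐ[Pr]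
      Pr[fun ω => max (f (t + 1) (X (t + 1) ω)) (q (t + 1) (X (t + 1) ω)) | F t] := by
    intro t ht
    refine (hqrec t ht).trans (condExp_eq_condExp_of_condIndep (hF t)
      (iSup₂_le fun s _ => (hX s).comap_le) (hle t) (hMarkov t) ?_ (hUL _))
    have hXt : Measurable[⨆ s ∈ Set.Icc (t + 1) T, MeasurableSpace.comap (X s) inferInstance]
        (X (t + 1)) := measurable_iff_comap_le.2
      (le_iSup₂_of_le (t + 1) (Set.mem_Icc.2 ⟨le_rfl, ht⟩) le_rfl)
    exact (((hf _).max (hq _)).comp hXt).stronglyMeasurable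
  have hVint : Integrable (fun ω => vartheta f h (t + 1) w fun s => X s ω) Pr := by
    obtain ⟨C, hC⟩ := exists_abs_vartheta_le hfb hhb (t + 1) w
    exact .of_bound (measurable_vartheta hX hf hh _ _).aestronglyMeasurable C
      (.of_forall fun ω => hC _)
  have hdiff : (fun ω => g (X t ω) - q t (X t ω)) =ᵐ[Pr]
      Pr[fun ω => vartheta f h (t + 1) w (fun s => X s ω) -
        max (f (t + 1) (X (t + 1) ω)) (q (t + 1) (X (t + 1) ω)) |
          MeasurableSpace.comap (X t) inferInstance] :=
    (hgrep.sub (hqrec t (by omega))).trans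
      (condExp_sub hVint ((hUL (t + 1)).integrable one_le_two) _).symm
  have hbound : eLpNorm (fun ω => g (X t ω) - q t (X t ω)) 2 Pr ≤
      ∑ s ∈ Icc (t + 1) (t + w + 1), eLpNorm (fun ω => h s (X s ω) - q s (X s ω)) 2 Pr :=
    ((eLpNorm_congr_ae (hdiff.trans (condExp_condExp_of_le (hle t) (hF t)).symm)).trans_le
      (eLpNorm_condExp_le_eLpNorm _ one_le_two)).trans
      (eLpNorm_condExp_vartheta_sub_le hF hmono hXF hf hfb hq hqb hh hhb hrec t w htw)
  have herr : ∀ s, MemLp (fun ω => h s (X s ω) - q s (X s ω)) 2 Pr := fun s =>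
    (hL s (hh s) (hhb s)).sub (hL s (hq s) (hqb s))
  rw [sqrt_integral_sq_map (hX t) (u := fun y => g y - q t y) (hg.sub (hq t))
      ((hL t hg hgb).sub (hL t (hq t) (hqb t))),
    sum_congr rfl fun s _ => sqrt_integral_sq_map (hX s)
      (u := fun y => h s y - q s y) ((hh s).sub (hq s)) (herr s),
    ← ENNReal.toReal_sum fun s _ => (herr s).eLpNorm_ne_top]
  exact ENNReal.toReal_mono (ENNReal.sum_ne_top.2 fun s _ => (herr s).eLpNorm_ne_top) hbound
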